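/- Let N be a positive integer and let z = ζ_1 + ζ_2 + ⋯ + ζ_N be a sum of N roots of unity in ℂ. If z/N is an algebraic integer, then either z = 0 or z/N is a root of unity (in which case |z| = N). -/

import Mathlib

/-- A nonzero average of roots of unity in a number field which is an algebraic integer
is itself a root of unity. -/
theorem NumberField.exists_pow_eq_one_of_isIntegral_average
    {K ι : Type*} [Field K] [NumberField K] [Fintype ι] (ζ : ι → K)
    (hζ : ∀ i, ∃ m : ℕ, 0 < m ∧ ζ i ^ m = 1)
    (hint : IsIntegral ℤ ((∑ i, ζ i) / Fintype.card ι))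
    (hne : (∑ i, ζ i) / Fintype.card ι ≠ 0) :
    ∃ m : ℕ, 0 < m ∧ ((∑ i, ζ i) / Fintype.card ι) ^ m = 1 := by
  obtain ⟨m, hm, h⟩ := NumberField.Embeddings.pow_eq_one_of_norm_le_one K ℂ hne hint fun φ ↦ by
    rw [map_div₀, map_sum, map_natCast, norm_div, Complex.norm_natCast]
    refine div_le_one_of_le₀ ((norm_sum_le _ _).trans_eq ?_) (Nat.cast_nonneg _)
    have hnorm (i : ι) : ‖φ (ζ i)‖ = 1 := by
      obtain ⟨m, hm, h⟩ := hζ i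
      exact Complex.norm_eq_one_of_pow_eq_one (by rw [← map_pow, h, map_one]) hm.ne'
    simp [hnorm]
  exact ⟨m, hm, h⟩

/-- If `z` is a sum of `N` roots of unity in ℂ and `z / N` is an algebraic integer,
then either `z = 0` or `z / N` is a root of unity, in which case `|z| = N`. -/
theorem sum_roots_of_unity_div_card_algebraic_integer
    (N : ℕ) (hN : 0 < N) (ζ : Fin N → ℂ)
    (hζ : ∀ i, ∃ m : ℕ, 0 < m ∧ ζ i ^ m = 1)
    (z : ℂ) (hz : z = ∑ i, ζ i)
    (hint : IsIntegral ℤ (z / N)) :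
    z = 0 ∨ ((∃ m : ℕ, 0 < m ∧ (z / N) ^ m = 1) ∧ ‖z‖ = N) := by
  refine or_iff_not_imp_left.2 fun hz0 ↦ ?_
  have hN0 : (N : ℂ) ≠ 0 := Nat.cast_ne_zero.2 hN.ne'
  let K := IntermediateField.adjoin ℚ (Set.range ζ)
  have : FiniteDimensional ℚ K := by
    refine IntermediateField.finiteDimensional_adjoin ?_
    rintro _ ⟨i, rfl⟩
    obtain ⟨m, hm, h⟩ := hζ i
    exact .of_pow hm (h ▸ isIntegral_one)
  have : NumberField K := { }
  let ξ (i : Fin N) : K := ⟨ζ i, IntermediateField.subset_adjoin ℚ _ ⟨i, rfl⟩⟩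
  have hξ : algebraMap K ℂ ((∑ i, ξ i) / Fintype.card (Fin N)) = z / N := by
    rw [map_div₀, map_sum, map_natCast, Fintype.card_fin, hz]
    rfl
  have hinj : Function.Injective (algebraMap K ℂ) := (algebraMap K ℂ).injective
  obtain ⟨m, hm, h⟩ := NumberField.exists_pow_eq_one_of_isIntegral_average ξ
    (fun i ↦ (hζ i).imp fun m h ↦ ⟨h.1, Subtype.ext h.2⟩)
    ((isIntegral_algebraMap_iff hinj).1 (hξ ▸ hint))
    (fun h ↦ div_ne_zero hz0 hN0 (by rw [← hξ, h, map_zero]))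
  have hpow : (z / N) ^ m = 1 := by rw [← hξ, ← map_pow, h, map_one]
  refine ⟨⟨m, hm, hpow⟩, ?_⟩
  have hnorm := Complex.norm_eq_one_of_pow_eq_one hpow hm.ne'
  rwa [norm_div, Complex.norm_natCast, div_eq_one_iff_eq (Nat.cast_ne_zero.2 hN.ne')] at hnorm
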